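/- Assume the operators L, B₃, …, B_{2g+1} commute. Then for every odd s with 1 ≤ s ≤ 2g−1, every i ∈ {1,2,3} and every odd j with 1 ≤ j ≤ 2g−1, one has ∂_s β_{i,j} = (D_s(b_{i,j}))(β) identically on Ω; that is, the partial derivatives of the functions β_{i,j} are computed by evaluating the polynomial vector fields D_s at β. -/

import Mathlib

open MvPolynomial

noncomputable section

/-- B_g = ℂ[b_{i,j} : i ∈ {1,2,3}, j odd, 1 ≤ j ≤ 2g−1], as a polynomial ring in 3g variables;
the variable (i, m) : Fin 3 × Fin g stands for b_{i+1, 2m+1}. -/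
abbrev Bg (g : ℕ) : Type := MvPolynomial (Fin 3 × Fin g) ℂ

/-- `bb g i m` is the variable b_{i, 2m−1} (zero if i ∉ {1,2,3} or m ∉ {1,…,g}). -/
noncomputable def bb (g : ℕ) (i m : ℕ) : Bg g :=
  if h : 1 ≤ i ∧ i ≤ 3 ∧ 1 ≤ m ∧ m ≤ g then
    MvPolynomial.X (⟨i - 1, by omega⟩, ⟨m - 1, by omega⟩) else 0

/-- `bv g i j` is the variable b_{i,j} for odd j (zero for j > 2g−1). -/
noncomputable def bv (g : ℕ) (i j : ℕ) : Bg g :=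
  if Odd j then bb g i ((j + 1) / 2) else 0

/-- `Qg g a c` is p_{2a−1, 2c−1} for 1 ≤ a ≤ c, by the elimination recursion. -/
noncomputable def Qg (g : ℕ) : ℕ → ℕ → Bg g
  | 0, _ => 0
  | 1, c => 2 * bb g 1 c
  | 2, c => 6 * bb g 1 1 * bb g 1 c - bb g 3 c + 6 * bb g 1 (c + 1)
  | 3, c => bb g 3 1 * bb g 1 c - bb g 2 1 * bb g 2 c + bb g 1 1 * bb g 3 c
      - 2 * (4 * bb g 1 1 ^ 2 + bb g 1 2) * bb g 1 c
      + 10 * bb g 1 1 * bb g 1 (c + 1) - 2 * bb g 3 (c + 1) + 10 * bb g 1 (c + 2)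
  | (a + 4), c => 2 * (if c + 1 ≤ g then Qg g (a + 3) (c + 1) else 0)
      - (if c + 2 ≤ g then Qg g (a + 2) (c + 2) else 0)
      - 8 * bb g 1 1 * bb g 1 (a + 2) * bb g 1 c - 2 * bb g 1 c * bb g 1 (a + 3)
      - 2 * bb g 1 (a + 2) * bb g 1 (c + 1) + bb g 1 (a + 2) * bb g 3 c
      - bb g 2 (a + 2) * bb g 2 c + bb g 3 (a + 2) * bb g 1 c

/-- `pp g k l` is p_{k,l} for odd k, l (zero if k > 2g−1 or l > 2g−1). -/
noncomputable def pp (g : ℕ) (k l : ℕ) : Bg g :=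
  if Odd k ∧ Odd l ∧ k ≤ 2 * g - 1 ∧ l ≤ 2 * g - 1 then
    if k ≤ l then Qg g ((k + 1) / 2) ((l + 1) / 2) else Qg g ((l + 1) / 2) ((k + 1) / 2)
  else 0

/-- 𝐛ᵢ(ξ) = Σ_{m=1}^{g} b_{i,2m−1} ξᵐ ∈ B_g[ξ]. -/
noncomputable def Bcoef (g i : ℕ) : Polynomial (Bg g) :=
  ∑ m ∈ Finset.Icc 1 g, Polynomial.C (bb g i m) * Polynomial.X ^ m

/-- The polynomial ξ𝐛₂(ξ)² + 2ξ𝐛₃(ξ)(1 − 𝐛₁(ξ)) + 4(1 + 2b_{1,1}ξ)(1 − 𝐛₁(ξ))². -/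
noncomputable def Fg (g : ℕ) : Polynomial (Bg g) :=
  Polynomial.X * (Bcoef g 2) ^ 2 + 2 * Polynomial.X * Bcoef g 3 * (1 - Bcoef g 1)
    + 4 * (1 + 2 * Polynomial.C (bb g 1 1) * Polynomial.X) * (1 - Bcoef g 1) ^ 2

/-- `lam g m` is λ_{2m+2}, defined by 4λ_{2m+2} = coefficient of ξ^{m+1} in `Fg g`. -/
noncomputable def lam (g m : ℕ) : Bg g := ((1 : ℂ) / 4) • ((Fg g).coeff (m + 1))

/-- The polynomial vector field D₁ on B_g:
D₁(b_{1,j}) = b_{2,j}, D₁(b_{2,j}) = b_{3,j},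
D₁(b_{3,j}) = 4(2b_{1,1}b_{2,j} + b_{2,1}b_{1,j} + b_{2,j+2}) (with b_{2,2g+1} = 0). -/
noncomputable def D1g (g : ℕ) : Derivation ℂ (Bg g) (Bg g) :=
  MvPolynomial.mkDerivation ℂ (fun v : Fin 3 × Fin g =>
    if (v.1 : ℕ) = 0 then bb g 2 ((v.2 : ℕ) + 1)
    else if (v.1 : ℕ) = 1 then bb g 3 ((v.2 : ℕ) + 1)
    else 4 * (2 * bb g 1 1 * bb g 2 ((v.2 : ℕ) + 1) + bb g 2 1 * bb g 1 ((v.2 : ℕ) + 1)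
      + bb g 2 ((v.2 : ℕ) + 2)))

/-- The polynomial vector field D_s on B_g (for odd s ≥ 3):
D_s(b_{i,j}) = (1/2)·D₁ⁱ(p_{s,j}); for s = 1 it is D₁.  (For s = 2g+1 the
conventions p_{s,j} = 0 make it the zero vector field.) -/
noncomputable def Dsg (g s : ℕ) : Derivation ℂ (Bg g) (Bg g) :=
  if s = 1 then D1g g else
  MvPolynomial.mkDerivation ℂ (fun v : Fin 3 × Fin g =>
    ((1 : ℂ) / 2) • (((D1g g).toLinearMap ^ ((v.1 : ℕ) + 1)) (pp g s (2 * (v.2 : ℕ) + 1))))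

/-- The multiplication operator by c ∈ B_g. -/
noncomputable def mulBg (g : ℕ) (c : Bg g) : Module.End ℂ (Bg g) := LinearMap.mulLeft ℂ c

/-- D_s as a ℂ-linear endomorphism of B_g. -/
noncomputable def DLg (g s : ℕ) : Module.End ℂ (Bg g) := (Dsg g s).toLinearMap

/-- ℒ = D₁² − 2b_{1,1}. -/
noncomputable def Lg (g : ℕ) : Module.End ℂ (Bg g) := DLg g 1 ^ 2 - mulBg g (2 * bb g 1 1)

/-- The Buchstaber–Shorina polynomial differential operator
ℬ_{2k+1} = D_{2k−1}D₁² − (b_{1,1}D_{2k−1} + D_{2k−1}b_{1,1})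
  − (1/2)(b_{1,2k−1}D₁ + D₁b_{1,2k−1}) − D_{2k+1}. -/
noncomputable def Bopg (g k : ℕ) : Module.End ℂ (Bg g) :=
  DLg g (2 * k - 1) * DLg g 1 ^ 2
    - (mulBg g (bb g 1 1) * DLg g (2 * k - 1) + DLg g (2 * k - 1) * mulBg g (bb g 1 1))
    - ((1 : ℂ) / 2) • (mulBg g (bv g 1 (2 * k - 1)) * DLg g 1 + DLg g 1 * mulBg g (bv g 1 (2 * k - 1)))
    - DLg g (2 * k + 1)

/-- The partial derivative ∂_{2m−1} with respect to the m-th coordinate t_{2m−1} of ℂᵍ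
(zero for m > g, in accordance with the convention ∂_{2g+1} = 0). -/
noncomputable def pd (g : ℕ) (m : ℕ) (f : (Fin g → ℂ) → ℂ) : (Fin g → ℂ) → ℂ :=
  fun t => if h : 1 ≤ m ∧ m - 1 < g then fderiv ℂ f t (Pi.single (⟨m - 1, h.2⟩ : Fin g) 1) else 0

/-- L f = ∂₁²f − v₂·f (here `v m` denotes v_{2m}). -/
noncomputable def Lfun (g : ℕ) (v : ℕ → (Fin g → ℂ) → ℂ) (f : (Fin g → ℂ) → ℂ) :
    (Fin g → ℂ) → ℂ :=
  pd g 1 (pd g 1 f) - v 1 * f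

/-- B_{2k+1} f = ∂_{2k−1}∂₁²f − (1/2)(v₂·∂_{2k−1}f + ∂_{2k−1}(v₂·f))
− (1/4)(v_{2k}·∂₁f + ∂₁(v_{2k}·f)) − ∂_{2k+1}f (with ∂_{2g+1} = 0). -/
noncomputable def Bfun (g : ℕ) (v : ℕ → (Fin g → ℂ) → ℂ) (k : ℕ) (f : (Fin g → ℂ) → ℂ) :
    (Fin g → ℂ) → ℂ :=
  pd g k (pd g 1 (pd g 1 f))
    - ((1 : ℂ) / 2) • (v 1 * pd g k f + pd g k (v 1 * f))
    - ((1 : ℂ) / 4) • (v k * pd g 1 f + pd g 1 (v k * f)) - pd g (k + 1) f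

/-- The operators L, B₃, …, B_{2g+1} commute (on holomorphic functions on Ω). -/
def OpsCommute (g : ℕ) (Ω : Set (Fin g → ℂ)) (v : ℕ → (Fin g → ℂ) → ℂ) : Prop :=
  ∀ f : (Fin g → ℂ) → ℂ, AnalyticOnNhd ℂ f Ω →
    ∀ k l, 1 ≤ k → k ≤ g → 1 ≤ l → l ≤ g →
      Set.EqOn (Lfun g v (Bfun g v k f)) (Bfun g v k (Lfun g v f)) Ω ∧
      Set.EqOn (Bfun g v k (Bfun g v l f)) (Bfun g v l (Bfun g v k f)) Ω


/-- β_{i,j} = (1/2)∂₁^{i−1} v_{j+1} for j = 2m−1 (here `v m` denotes v_{2m}). -/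
noncomputable def betaf (g : ℕ) (v : ℕ → (Fin g → ℂ) → ℂ) (i m : ℕ) : (Fin g → ℂ) → ℂ :=
  fun t => ((1 : ℂ) / 2) * ((pd g 1)^[i - 1] (v m)) t

/-- Evaluation of a polynomial P ∈ B_g at the point β(t). -/
noncomputable def evalBeta (g : ℕ) (v : ℕ → (Fin g → ℂ) → ℂ) (t : Fin g → ℂ) (P : Bg g) : ℂ :=
  MvPolynomial.eval (fun w : Fin 3 × Fin g => betaf g v ((w.1 : ℕ) + 1) ((w.2 : ℕ) + 1) t) P

theorem commutator_reduction {S : Type*} [Ring S] {E E' G G' L : S} (hE : E * E' = E' * E)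
    (hG : L * (4 * E * L + G) = (4 * E * L + G) * L)
    (hG' : L * (4 * E' * L + G') = (4 * E' * L + G') * L)
    (h : (4 * E * L + G) * (4 * E' * L + G') = (4 * E' * L + G') * (4 * E * L + G)) :
    4 * ((E * G' - G' * E) - (E' * G - G * E')) * L + (G * G' - G' * G) = 0 := by
  linear_combination (norm := noncomm_ring) h - 4 * E * hG' + 4 * E' * hG - 16 * hE * L * L

section DifferentialAlgebra

variable {R : Type*} [CommRing R] [Algebra ℂ R]

theorem eq_zero_of_natCast_mul {n : ℕ} (hn : n ≠ 0) {a : R} (h : (n : R) * a = 0) : a = 0 := by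
  have : ((n : ℂ)⁻¹ * n) • a = 0 := by
    rw [mul_smul, Nat.cast_smul_eq_nsmul, nsmul_eq_mul, h, smul_zero]
  rwa [inv_mul_cancel₀ (by exact_mod_cast hn), one_smul] at this

theorem derivation_ofNat (D : Derivation ℂ R R) (n : ℕ) [n.AtLeastTwo] :
    D (ofNat(n) : R) = 0 := by
  exact_mod_cast D.map_natCast n

/-- Four times the operator `B` attached to commuting derivations `D`, `E`, `F` of an algebra and
the potentials `u`, `v`. -/
def fourB (D E F : Derivation ℂ R R) (u v f : R) : R :=
  4 * E (D (D f)) - 2 * (u * E f + E (u * f)) - (v * D f + D (v * f)) - 4 * F f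

theorem relations_of_commute_L {D E F : Derivation ℂ R R} (hDE : ∀ f, E (D f) = D (E f))
    (hDF : ∀ f, F (D f) = D (F f)) {x u v : R} (hx : D x = 1)
    (h : ∀ f, D (D (fourB D E F u v f)) - u * fourB D E F u v f
      = fourB D E F u v (D (D f) - u * f)) :
    E u = D v ∧ 4 * F u = D (D (D v)) - 4 * u * D v - 2 * v * D u := by
  have key : ∀ f, 4 * (E u - D v) * D (D f) + 4 * (D (E u) - D (D v)) * D f
      + (2 * D (D (E u)) - D (D (D v)) - 4 * u * E u - 2 * v * D u - 4 * F u) * f = 0 := by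
    intro f
    have := h f
    simp only [fourB, map_sub, map_add, Derivation.leibniz, smul_eq_mul, hDE, hDF,
      derivation_ofNat, map_zero] at this
    linear_combination this
  have h1 := key 1
  have h2 := key x
  have h3 := key (x * x)
  simp only [Derivation.leibniz, hx, D.map_one_eq_zero, smul_eq_mul, map_add, mul_one, mul_zero,
    add_zero, zero_add, map_zero] at h1 h2 h3
  have hEu : E u - D v = 0 :=
    eq_zero_of_natCast_mul (n := 8) (by norm_num)
      (by push_cast; linear_combination h3 - 2 * x * h2 + x * x * h1)
  have hEu' := congrArg (fun a => D (D a)) hEu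
  simp only [map_sub, map_zero] at hEu'
  exact ⟨sub_eq_zero.mp hEu, by linear_combination -h1 + 2 * hEu' - 4 * u * hEu⟩

theorem relations_of_commute_B {D E F E' F' : Derivation ℂ R R} (hDE : ∀ f, E (D f) = D (E f))
    (hDF : ∀ f, F (D f) = D (F f)) (hDE' : ∀ f, E' (D f) = D (E' f))
    (hDF' : ∀ f, F' (D f) = D (F' f))
    (hEE' : ∀ f, E (E' f) = E' (E f)) (hEF' : ∀ f, E (F' f) = F' (E f))
    (hFE' : ∀ f, F (E' f) = E' (F f)) (hFF' : ∀ f, F (F' f) = F' (F f))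
    {x u v w : R} (hx : D x = 1) (hu : E u = D v) (hu' : E' u = D w)
    (hL : ∀ f, D (D (fourB D E F u v f)) - u * fourB D E F u v f
      = fourB D E F u v (D (D f) - u * f))
    (hL' : ∀ f, D (D (fourB D E' F' u w f)) - u * fourB D E' F' u w f
      = fourB D E' F' u w (D (D f) - u * f))
    (hB : ∀ f, fourB D E F u v (fourB D E' F' u w f) = fourB D E' F' u w (fourB D E F u v f)) :
    E w = E' v ∧ 2 * (F w - F' v) = w * D v - v * D w := by
  let L : Module.End ℂ R := D.toLinearMap * D.toLinearMap - LinearMap.mulLeft ℂ u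
  let G (D F : Derivation ℂ R R) (v : R) : Module.End ℂ R :=
    LinearMap.mulLeft ℂ (D v) - 2 * (LinearMap.mulLeft ℂ v * D.toLinearMap) - 4 * F.toLinearMap
  have hfour : ∀ (E F : Derivation ℂ R R) (v f : R), E u = D v →
      (4 * E.toLinearMap * L + G D F v) f = fourB D E F u v f := by
    intro E F v f hu
    simp only [L, G, fourB, LinearMap.add_apply, LinearMap.sub_apply, Module.End.mul_apply,
      Module.End.ofNat_apply, LinearMap.mulLeft_apply, Derivation.coeFn_coe, map_sub,
      Derivation.leibniz, smul_eq_mul, nsmul_eq_mul, hu]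
    push_cast
    ring
  have key := commutator_reduction (E := E.toLinearMap) (E' := E'.toLinearMap) (G := G D F v)
    (G' := G D F' w) (L := L) (by ext f; exact hEE' f)
    (by ext f; simpa [hfour _ _ _ _ hu, L] using hL f)
    (by ext f; simpa [hfour _ _ _ _ hu', L] using hL' f)
    (by ext f; simpa [hfour _ _ _ _ hu', hfour _ _ _ _ hu] using hB f)
  have key : ∀ f, -8 * (E w - E' v) * D (D (D f)) + 4 * D (E w - E' v) * D (D f)
      + (8 * (E w - E' v) * u + 4 * (v * D w - w * D v) + 8 * (F w - F' v)) * D f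
      + (8 * (E w - E' v) * D u - 4 * D (E w - E' v) * u - 2 * (v * D (D w) - w * D (D v))
         - 4 * D (F w - F' v)) * f = 0 := by
    intro f
    have := LinearMap.congr_fun key f
    simp only [L, G, LinearMap.add_apply, LinearMap.sub_apply, Module.End.mul_apply,
      Module.End.ofNat_apply, LinearMap.mulLeft_apply, Derivation.coeFn_coe, map_sub, map_add,
      Derivation.leibniz, smul_eq_mul, nsmul_eq_mul, LinearMap.zero_apply,
      hDE, hDF, hDE', hDF', hEF', hFF', hFE', Derivation.map_natCast] at this
    push_cast at this
    simp only [map_sub]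
    linear_combination this
  have h1 := key 1
  have h2 := key x
  have h3 := key (x * x)
  have h4 := key (x * x * x)
  simp only [Derivation.leibniz, hx, D.map_one_eq_zero, smul_eq_mul, map_add, mul_one, mul_zero,
    add_zero, zero_add, map_zero] at h1 h2 h3 h4
  have hP : E w - E' v = 0 :=
    eq_zero_of_natCast_mul (n := 48) (by norm_num)
      (by push_cast; linear_combination -h4 + 3 * x * h3 - 3 * x * x * h2 + x * x * x * h1)
  have hQ : 2 * (F w - F' v) - (w * D v - v * D w) = 0 :=
    eq_zero_of_natCast_mul (n := 4) (by norm_num)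
      (by push_cast; linear_combination h2 - x * h1 - 8 * u * hP)
  exact ⟨sub_eq_zero.mp hP, sub_eq_zero.mp hQ⟩

theorem ofNat_mul_eq_smul (n : ℕ) [n.AtLeastTwo] (a : R) :
    (ofNat(n) : R) * a = (ofNat(n) : ℂ) • a := by
  rw [Algebra.smul_def, map_ofNat]

theorem fourB_smul (D E F : Derivation ℂ R R) (u v : R) (c : ℂ) (f : R) :
    fourB D E F u v (c • f) = c • fourB D E F u v f := by
  simp only [fourB, Derivation.map_smul, mul_smul_comm, smul_sub, smul_add, mul_add]

/-- The values taken by the variables `b_{i,j}` in a differential algebra. -/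
def betaVal (g : ℕ) (D : Derivation ℂ R R) (b : ℕ → R) (w : Fin 3 × Fin g) : R :=
  D^[w.1] (b (w.2 + 1))

theorem aeval_bb {g : ℕ} (D : Derivation ℂ R R) {b : ℕ → R} (hb : ∀ m, g < m → b m = 0)
    {i m : ℕ} (hi : 1 ≤ i) (hi' : i ≤ 3) (hm : 1 ≤ m) :
    aeval (betaVal g D b) (bb g i m) = D^[i - 1] (b m) := by
  by_cases h : m ≤ g
  · rw [bb, dif_pos ⟨hi, hi', hm, h⟩, aeval_X, betaVal]
    simp only [Nat.sub_add_cancel hm]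
  · rw [bb, dif_neg (by omega), hb m (by omega), map_zero, iterate_map_zero]

theorem aeval_D1g {g : ℕ} {D : Derivation ℂ R R} {b : ℕ → R} (hb : ∀ m, g < m → b m = 0)
    (hD : ∀ m, 1 ≤ m → m ≤ g →
      D (D (D (b m))) = 4 * (2 * b 1 * D (b m) + D (b 1) * b m + D (b (m + 1)))) (P : Bg g) :
    aeval (betaVal g D b) (D1g g P) = D (aeval (betaVal g D b) P) := by
  induction P using MvPolynomial.induction_on with
  | C a => rw [← algebraMap_eq]; simp
  | add p q hp hq => simp [hp, hq]
  | mul_X p w hp =>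
    have hX : aeval (betaVal g D b) (D1g g (X w)) = D (betaVal g D b w) := by
      obtain ⟨i, m⟩ := w
      have hm := hD (m + 1) (by omega) (by omega)
      fin_cases i <;> simp [D1g, mkDerivation_X, betaVal, aeval_bb D hb, hm]
    simp only [Derivation.leibniz, map_add, smul_eq_mul, map_mul, hp, hX, aeval_X]

theorem two_mul_apply_eq_aeval_Qg {g : ℕ} {δ : ℕ → Derivation ℂ R R} {b : ℕ → R}
    (hb : ∀ m, g < m → b m = 0)
    (hD : ∀ m, 1 ≤ m → m ≤ g → δ 1 (δ 1 (δ 1 (b m))) =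
      4 * (2 * b 1 * δ 1 (b m) + δ 1 (b 1) * b m + δ 1 (b (m + 1))))
    (hrec : ∀ k l, 1 ≤ k → k ≤ g → 1 ≤ l → l ≤ g →
      δ (k + 1) (b l) = δ k (b (l + 1)) + b l * δ 1 (b k) - b k * δ 1 (b l))
    (a : ℕ) (ha : 1 ≤ a) (hag : a ≤ g) :
    ∀ c, 1 ≤ c → 2 * δ a (b c) = δ 1 (aeval (betaVal g (δ 1) b) (Qg g a c)) := by
  have hrec' : ∀ k l, 1 ≤ k → k ≤ g → 1 ≤ l →
      δ (k + 1) (b l) = δ k (b (l + 1)) + b l * δ 1 (b k) - b k * δ 1 (b l) := by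
    intro k l hk hkg hl
    by_cases hlg : l ≤ g
    · exact hrec k l hk hkg hl hlg
    · simp [hb l (by omega), hb (l + 1) (by omega)]
  have hD' : ∀ m, 1 ≤ m → δ 1 (δ 1 (δ 1 (b m))) =
      4 * (2 * b 1 * δ 1 (b m) + δ 1 (b 1) * b m + δ 1 (b (m + 1))) := by
    intro m hm
    by_cases hmg : m ≤ g
    · exact hD m hm hmg
    · simp [hb m (by omega), hb (m + 1) (by omega)]
  induction a using Nat.strong_induction_on with
  | _ a ih =>
  intro c hc
  match a, ha, hag, ih with
  | 1, _, _, _ => simp [Qg, aeval_bb (δ 1) hb, hc, derivation_ofNat]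
  | 2, _, _, _ =>
    simp [Qg, aeval_bb (δ 1) hb, hc, derivation_ofNat]
    linear_combination 2 * hrec' 1 c le_rfl (by omega) hc + hD' c hc
  | 3, _, _, _ =>
    simp [Qg, aeval_bb (δ 1) hb, hc, derivation_ofNat]
    linear_combination 2 * hrec' 2 c (by omega) (by omega) hc
      + 2 * hrec' 1 (c + 1) le_rfl (by omega) (by omega) - b 1 * hD' c hc - b c * hD' 1 le_rfl
      + 2 * hD' (c + 1) (by omega)
  | a + 4, _, hag, ih =>
    have hif : ∀ k m, 1 ≤ k → k < a + 4 → 1 ≤ m →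
        δ 1 (aeval (betaVal g (δ 1) b) (if m ≤ g then Qg g k m else 0)) = 2 * δ k (b m) := by
      intro k m hk hka hm
      split_ifs with h
      · exact (ih k hka hk (by omega) m hm).symm
      · simp [hb m (by omega)]
    have h₁ := hif (a + 3) (c + 1) (by omega) (by omega) (by omega)
    have h₂ := hif (a + 2) (c + 2) (by omega) (by omega) (by omega)
    rw [Qg]
    generalize (if c + 1 ≤ g then Qg g (a + 3) (c + 1) else 0) = P₁ at h₁ ⊢
    generalize (if c + 2 ≤ g then Qg g (a + 2) (c + 2) else 0) = P₂ at h₂ ⊢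
    simp [aeval_bb (δ 1) hb, hc, derivation_ofNat]
    linear_combination 2 * hrec' (a + 3) c (by omega) (by omega) hc
      - 2 * hrec' (a + 2) (c + 1) (by omega) (by omega) (by omega) - b (a + 2) * hD' c hc
      - b c * hD' (a + 2) (by omega) - 2 * h₁ + h₂

/-- If the operators commute, then the derivatives `δ s (b_{i,m})` are given by the
polynomial vector fields `Dsg`. -/
theorem derivation_aeval_bb {g : ℕ} {δ : ℕ → Derivation ℂ R R} {b : ℕ → R}
    (hcomm : ∀ k l f, δ k (δ l f) = δ l (δ k f)) (hδ : ∀ k, g < k → δ k = 0)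
    (hb : ∀ m, g < m → b m = 0) {x : R} (hx : δ 1 x = 1)
    (hL : ∀ k f, 1 ≤ k → k ≤ g →
      δ 1 (δ 1 (fourB (δ 1) (δ k) (δ (k + 1)) (2 * b 1) (2 * b k) f))
          - 2 * b 1 * fourB (δ 1) (δ k) (δ (k + 1)) (2 * b 1) (2 * b k) f
        = fourB (δ 1) (δ k) (δ (k + 1)) (2 * b 1) (2 * b k) (δ 1 (δ 1 f) - 2 * b 1 * f))
    (hB : ∀ k l f, 1 ≤ k → k ≤ g → 1 ≤ l → l ≤ g →
      fourB (δ 1) (δ k) (δ (k + 1)) (2 * b 1) (2 * b k)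
          (fourB (δ 1) (δ l) (δ (l + 1)) (2 * b 1) (2 * b l) f)
        = fourB (δ 1) (δ l) (δ (l + 1)) (2 * b 1) (2 * b l)
          (fourB (δ 1) (δ k) (δ (k + 1)) (2 * b 1) (2 * b k) f))
    {s i m : ℕ} (hs : 1 ≤ s) (hsg : s ≤ g) (hi : 1 ≤ i) (hi' : i ≤ 3) (hm : 1 ≤ m) (hmg : m ≤ g) :
    δ s ((δ 1)^[i - 1] (b m)) = aeval (betaVal g (δ 1) b) (Dsg g (2 * s - 1) (bb g i m)) := by
  have hLrel k (hk : 1 ≤ k) (hkg : k ≤ g) := relations_of_commute_L (hcomm k 1) (hcomm (k + 1) 1)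
    hx (hL k · hk hkg)
  have hBrel k l (hk : 1 ≤ k) (hkg : k ≤ g) (hl : 1 ≤ l) (hlg : l ≤ g) :=
    relations_of_commute_B (hcomm k 1) (hcomm (k + 1) 1) (hcomm l 1) (hcomm (l + 1) 1)
      (hcomm k l) (hcomm k (l + 1)) (hcomm (k + 1) l) (hcomm (k + 1) (l + 1)) hx
      (hLrel k hk hkg).1 (hLrel l hl hlg).1 (hL k · hk hkg) (hL l · hl hlg)
      (hB k l · hk hkg hl hlg)
  simp only [Derivation.leibniz, derivation_ofNat, smul_eq_mul, mul_zero, add_zero] at hLrel hBrel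
  have hsymm k l (hk : 1 ≤ k) (hkg : k ≤ g) (hl : 1 ≤ l) (hlg : l ≤ g) :
      δ k (b l) = δ l (b k) :=
    sub_eq_zero.mp <| eq_zero_of_natCast_mul (n := 2) two_ne_zero <| by
      push_cast
      linear_combination (hBrel k l hk hkg hl hlg).1
  have hsucc k l (hk : 1 ≤ k) (hkg : k ≤ g) (hl : 1 ≤ l) (hlg : l ≤ g) :
      δ (l + 1) (b k) = δ k (b (l + 1)) := by
    rcases hlg.lt_or_eq with h | rfl
    · exact hsymm _ _ (by omega) h hk hkg
    · simp [hb, hδ]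
  have hrec k l (hk : 1 ≤ k) (hkg : k ≤ g) (hl : 1 ≤ l) (hlg : l ≤ g) :
      δ (k + 1) (b l) = δ k (b (l + 1)) + b l * δ 1 (b k) - b k * δ 1 (b l) :=
    sub_eq_zero.mp <| eq_zero_of_natCast_mul (n := 4) four_ne_zero <| by
      push_cast
      linear_combination (hBrel k l hk hkg hl hlg).2 + 4 * hsucc k l hk hkg hl hlg
  have hD m (hm : 1 ≤ m) (hmg : m ≤ g) : δ 1 (δ 1 (δ 1 (b m))) =
      4 * (2 * b 1 * δ 1 (b m) + δ 1 (b 1) * b m + δ 1 (b (m + 1))) :=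
    sub_eq_zero.mp <| eq_zero_of_natCast_mul (n := 2) two_ne_zero <| by
      push_cast
      linear_combination -(hLrel m hm hmg).2 + 8 * hsucc 1 m le_rfl (by omega) hm hmg
  rcases eq_or_ne s 1 with rfl | hs1
  · rw [Dsg, if_pos rfl, aeval_D1g hb hD, aeval_bb _ hb hi hi' hm]
  have hpow (n : ℕ) (P : Bg g) : aeval (betaVal g (δ 1) b) (((D1g g).toLinearMap ^ n) P)
      = (δ 1)^[n] (aeval (betaVal g (δ 1) b) P) := by
    induction n with
    | zero => rfl
    | succ n ih =>
      rw [pow_succ', Module.End.mul_apply, Function.iterate_succ_apply', ← ih]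
      exact aeval_D1g hb hD _
  have hpp : δ 1 (aeval (betaVal g (δ 1) b) (pp g (2 * s - 1) (2 * m - 1))) = 2 * δ s (b m) := by
    have h₁ : (2 * s - 1 + 1) / 2 = s := by omega
    have h₂ : (2 * m - 1 + 1) / 2 = m := by omega
    rw [pp, if_pos ⟨⟨s - 1, by omega⟩, ⟨m - 1, by omega⟩, by omega, by omega⟩, h₁, h₂]
    split_ifs
    · exact (two_mul_apply_eq_aeval_Qg hb hD hrec s hs hsg m hm).symm
    · rw [hsymm s m hs hsg hm hmg]
      exact (two_mul_apply_eq_aeval_Qg hb hD hrec m hm hmg s hs).symm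
  have hiter (n : ℕ) (f : R) : (δ 1)^[n] (δ s f) = δ s ((δ 1)^[n] f) :=
    (Function.Commute.iterate_left (f := δ 1) (g := δ s) (hcomm 1 s) n) f
  obtain ⟨j, rfl⟩ : ∃ j, i = j + 1 := ⟨i - 1, by omega⟩
  rw [Dsg, if_neg (by omega), bb, dif_pos ⟨hi, hi', hm, hmg⟩, mkDerivation_X, map_smul, hpow]
  simp only [Nat.add_sub_cancel]
  rw [show 2 * (m - 1) + 1 = 2 * m - 1 by omega, Function.iterate_succ_apply, hpp, ← hiter]
  rw [ofNat_mul_eq_smul, Function.Commute.iterate_left (f := δ 1) (g := ((2 : ℂ) • ·))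
    (fun f => (δ 1).map_smul 2 f) j, smul_smul]
  norm_num

end DifferentialAlgebra

section Holomorphic

variable {g : ℕ} {Ω : Set (Fin g → ℂ)}

theorem pd_eqOn (hΩ : IsOpen Ω) {m : ℕ} {F G : (Fin g → ℂ) → ℂ} (h : Set.EqOn F G Ω) :
    Set.EqOn (pd g m F) (pd g m G) Ω := by
  intro t ht
  simp only [pd, (h.eventuallyEq_of_mem (hΩ.mem_nhds ht)).fderiv_eq]

theorem AnalyticOnNhd.pd {F : (Fin g → ℂ) → ℂ} (hF : AnalyticOnNhd ℂ F Ω) (m : ℕ) :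
    AnalyticOnNhd ℂ (pd g m F) Ω := by
  unfold _root_.pd
  split_ifs with h
  · exact (ContinuousLinearMap.apply ℂ ℂ
      (Pi.single (⟨m - 1, h.2⟩ : Fin g) (1 : ℂ))).comp_analyticOnNhd hF.fderiv
  · exact analyticOnNhd_const

theorem pd_comm {F : (Fin g → ℂ) → ℂ} (hF : AnalyticOnNhd ℂ F Ω) (k l : ℕ) :
    Set.EqOn (pd g k (pd g l F)) (pd g l (pd g k F)) Ω := by
  intro t ht
  unfold pd
  split_ifs with hk hl hl
  · rw [fderiv_clm_apply (hF.fderiv t ht).differentiableAt (differentiableAt_const _),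
      fderiv_clm_apply (hF.fderiv t ht).differentiableAt (differentiableAt_const _)]
    simpa using (hF t ht).contDiffAt.isSymmSndFDerivAt (n := ⊤) (by simp) _ _
  all_goals simp

variable (Ω) in
/-- The algebra of holomorphic functions on `Ω`. -/
def holo : Subalgebra ℂ (Ω → ℂ) where
  carrier := {f | ∃ F, AnalyticOnNhd ℂ F Ω ∧ f = Ω.domRestrict F}
  mul_mem' := by
    rintro _ _ ⟨F, hF, rfl⟩ ⟨G, hG, rfl⟩
    exact ⟨F * G, hF.mul hG, rfl⟩
  add_mem' := by
    rintro _ _ ⟨F, hF, rfl⟩ ⟨G, hG, rfl⟩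
    exact ⟨F + G, hF.add hG, rfl⟩
  algebraMap_mem' c := ⟨fun _ => c, analyticOnNhd_const, rfl⟩

/-- Restriction to `Ω`. -/
def toHolo {F : (Fin g → ℂ) → ℂ} (hF : AnalyticOnNhd ℂ F Ω) : holo Ω :=
  ⟨Ω.domRestrict F, F, hF, rfl⟩

theorem exists_eq_toHolo (f : holo Ω) :
    ∃ (F : (Fin g → ℂ) → ℂ) (hF : AnalyticOnNhd ℂ F Ω), f = toHolo hF :=
  let ⟨F, hF, h⟩ := f.2
  ⟨F, hF, Subtype.ext h⟩

theorem toHolo_eq_iff {F G : (Fin g → ℂ) → ℂ} {hF : AnalyticOnNhd ℂ F Ω}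
    {hG : AnalyticOnNhd ℂ G Ω} : toHolo hF = toHolo hG ↔ Set.EqOn F G Ω := by
  rw [Subtype.ext_iff]
  exact Set.domRestrict_eq_domRestrict_iff

/-- A holomorphic function extending `f`. -/
def holoExt (f : holo Ω) : (Fin g → ℂ) → ℂ := (exists_eq_toHolo f).choose

theorem analyticOnNhd_holoExt (f : holo Ω) : AnalyticOnNhd ℂ (holoExt f) Ω :=
  (exists_eq_toHolo f).choose_spec.choose

theorem toHolo_holoExt (f : holo Ω) : toHolo (analyticOnNhd_holoExt f) = f :=
  (exists_eq_toHolo f).choose_spec.choose_spec.symm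

theorem toHolo_pd_holoExt (hΩ : IsOpen Ω) (m : ℕ) {F : (Fin g → ℂ) → ℂ}
    (hF : AnalyticOnNhd ℂ F Ω) :
    toHolo ((analyticOnNhd_holoExt (toHolo hF)).pd m) = toHolo (hF.pd m) :=
  toHolo_eq_iff.2 (pd_eqOn hΩ (toHolo_eq_iff.1 (toHolo_holoExt _)))

/-- The partial derivative as a derivation of the algebra of holomorphic functions. -/
def holoPd (hΩ : IsOpen Ω) (m : ℕ) : Derivation ℂ (holo Ω) (holo Ω) :=
  Derivation.mk'
    { toFun := fun f => toHolo ((analyticOnNhd_holoExt f).pd m)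
      map_add' := by
        intro f f'
        obtain ⟨F, hF, rfl⟩ := exists_eq_toHolo f
        obtain ⟨G, hG, rfl⟩ := exists_eq_toHolo f'
        rw [show toHolo hF + toHolo hG = toHolo (hF.add hG) from rfl]
        simp only [toHolo_pd_holoExt hΩ]
        refine (toHolo_eq_iff (hF := (hF.add hG).pd m)
          (hG := (hF.pd m).add (hG.pd m))).2 fun t ht => ?_
        simp only [pd, Pi.add_apply]
        split_ifs
        · rw [fderiv_add (hF t ht).differentiableAt (hG t ht).differentiableAt]; rfl
        · simp
      map_smul' := by
        intro c f
        obtain ⟨F, hF, rfl⟩ := exists_eq_toHolo f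
        rw [show c • toHolo hF = toHolo (hF.const_smul (c := c)) from rfl]
        simp only [toHolo_pd_holoExt hΩ]
        refine (toHolo_eq_iff (hF := hF.const_smul.pd m)
          (hG := (hF.pd m).const_smul (c := c))).2 fun t ht => ?_
        simp only [pd, Pi.smul_apply]
        split_ifs
        · rw [fderiv_const_smul (hF t ht).differentiableAt]; rfl
        · simp }
    (by
      intro f f'
      obtain ⟨F, hF, rfl⟩ := exists_eq_toHolo f
      obtain ⟨G, hG, rfl⟩ := exists_eq_toHolo f'
      rw [show toHolo hF * toHolo hG = toHolo (hF.mul hG) from rfl]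
      simp only [LinearMap.coe_mk, AddHom.coe_mk, toHolo_pd_holoExt hΩ]
      refine (toHolo_eq_iff (hF := (hF.mul hG).pd m)
        (hG := (hF.mul (hG.pd m)).add (hG.mul (hF.pd m)))).2 fun t ht => ?_
      simp only [pd, Pi.add_apply]
      split_ifs
      · rw [fderiv_fun_mul (hF t ht).differentiableAt (hG t ht).differentiableAt]; rfl
      · simp)

theorem holoPd_toHolo (hΩ : IsOpen Ω) (m : ℕ) {F : (Fin g → ℂ) → ℂ}
    (hF : AnalyticOnNhd ℂ F Ω) : holoPd hΩ m (toHolo hF) = toHolo (hF.pd m) :=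
  toHolo_pd_holoExt hΩ m hF

theorem holoPd_comm (hΩ : IsOpen Ω) (k l : ℕ) (f : holo Ω) :
    holoPd hΩ k (holoPd hΩ l f) = holoPd hΩ l (holoPd hΩ k f) := by
  obtain ⟨F, hF, rfl⟩ := exists_eq_toHolo f
  simp only [holoPd_toHolo]
  exact toHolo_eq_iff.2 (pd_comm hF k l)

theorem holoPd_eq_zero (hΩ : IsOpen Ω) {k : ℕ} (hk : g < k) : holoPd hΩ k = 0 := by
  ext f : 1
  obtain ⟨F, hF, rfl⟩ := exists_eq_toHolo f
  rw [holoPd_toHolo]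
  refine (toHolo_eq_iff (hG := analyticOnNhd_const (v := 0))).2 fun t _ => ?_
  rw [pd, dif_neg (by omega)]

theorem exists_holoPd_one_eq_one (hΩ : IsOpen Ω) (hg : 1 ≤ g) :
    ∃ x : holo Ω, holoPd hΩ 1 x = 1 := by
  have hF : AnalyticOnNhd ℂ (fun t : Fin g → ℂ => t ⟨0, hg⟩) Ω :=
    (ContinuousLinearMap.proj (R := ℂ) (φ := fun _ : Fin g => ℂ) ⟨0, hg⟩).analyticOnNhd Ω
  refine ⟨toHolo hF, ?_⟩
  rw [holoPd_toHolo]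
  refine (toHolo_eq_iff (hG := analyticOnNhd_const (v := 1))).2 fun t _ => ?_
  rw [pd, dif_pos ⟨le_rfl, hg⟩]
  change fderiv ℂ (ContinuousLinearMap.proj (R := ℂ) (φ := fun _ : Fin g => ℂ) ⟨0, hg⟩) t _ = 1
  rw [ContinuousLinearMap.fderiv]
  simp

theorem AnalyticOnNhd.lfun {v : ℕ → (Fin g → ℂ) → ℂ} (hv : AnalyticOnNhd ℂ (v 1) Ω)
    {F : (Fin g → ℂ) → ℂ} (hF : AnalyticOnNhd ℂ F Ω) : AnalyticOnNhd ℂ (Lfun g v F) Ω :=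
  ((hF.pd 1).pd 1).sub (hv.mul hF)

theorem AnalyticOnNhd.bfun {v : ℕ → (Fin g → ℂ) → ℂ} {k : ℕ} (hv : AnalyticOnNhd ℂ (v 1) Ω)
    (hvk : AnalyticOnNhd ℂ (v k) Ω) {F : (Fin g → ℂ) → ℂ} (hF : AnalyticOnNhd ℂ F Ω) :
    AnalyticOnNhd ℂ (Bfun g v k F) Ω :=
  (((((hF.pd 1).pd 1).pd k).sub ((hv.mul (hF.pd k)).add ((hv.mul hF).pd k)).const_smul).sub
    ((hvk.mul (hF.pd 1)).add ((hvk.mul hF).pd 1)).const_smul).sub (hF.pd (k + 1))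

theorem holoPd_sub_mul_toHolo (hΩ : IsOpen Ω) {v : ℕ → (Fin g → ℂ) → ℂ}
    (hv : AnalyticOnNhd ℂ (v 1) Ω) {F : (Fin g → ℂ) → ℂ} (hF : AnalyticOnNhd ℂ F Ω) :
    holoPd hΩ 1 (holoPd hΩ 1 (toHolo hF)) - toHolo hv * toHolo hF = toHolo (hv.lfun hF) := by
  simp only [holoPd_toHolo]
  rfl

theorem fourB_toHolo (hΩ : IsOpen Ω) {v : ℕ → (Fin g → ℂ) → ℂ} {k : ℕ}
    (hv : AnalyticOnNhd ℂ (v 1) Ω) (hvk : AnalyticOnNhd ℂ (v k) Ω)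
    {F : (Fin g → ℂ) → ℂ} (hF : AnalyticOnNhd ℂ F Ω) :
    fourB (holoPd hΩ 1) (holoPd hΩ k) (holoPd hΩ (k + 1)) (toHolo hv) (toHolo hvk) (toHolo hF)
      = (4 : ℂ) • toHolo (hv.bfun hvk hF) := by
  rw [fourB, show toHolo hv * toHolo hF = toHolo (F := v 1 * F) (hv.mul hF) from rfl,
    show toHolo hvk * toHolo hF = toHolo (F := v k * F) (hvk.mul hF) from rfl]
  simp only [holoPd_toHolo, ofNat_mul_eq_smul]
  ext t
  change (4 : ℂ) * _ - (2 : ℂ) * (_ * _ + _) - (_ * _ + _) - (4 : ℂ) * _ =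
    4 * (_ - 1 / 2 * (_ * _ + _) - 1 / 4 * (_ * _ + _) - _)
  simp only [toHolo, Set.domRestrict_apply]
  ring

theorem AnalyticOnNhd.iterate_pd {F : (Fin g → ℂ) → ℂ} (hF : AnalyticOnNhd ℂ F Ω) (m n : ℕ) :
    AnalyticOnNhd ℂ ((_root_.pd g m)^[n] F) Ω := by
  induction n with
  | zero => exact hF
  | succ n ih => rw [Function.iterate_succ_apply']; exact ih.pd m

theorem iterate_holoPd_toHolo (hΩ : IsOpen Ω) {F : (Fin g → ℂ) → ℂ}
    (hF : AnalyticOnNhd ℂ F Ω) (m n : ℕ) :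
    (holoPd hΩ m)^[n] (toHolo hF) = toHolo (hF.iterate_pd m n) := by
  induction n with
  | zero => rfl
  | succ n ih =>
    rw [Function.iterate_succ_apply', ih, holoPd_toHolo]
    exact toHolo_eq_iff.2 fun t _ => by rw [Function.iterate_succ_apply']

theorem analyticOnNhd_betaf {v : ℕ → (Fin g → ℂ) → ℂ} {m : ℕ} (hv : AnalyticOnNhd ℂ (v m) Ω)
    (i : ℕ) : AnalyticOnNhd ℂ (betaf g v i m) Ω :=
  analyticOnNhd_const.mul (hv.iterate_pd 1 (i - 1))

theorem iterate_holoPd_half_smul (hΩ : IsOpen Ω) {v : ℕ → (Fin g → ℂ) → ℂ} {m : ℕ}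
    (hv : AnalyticOnNhd ℂ (v m) Ω) (i : ℕ) :
    (holoPd hΩ 1)^[i - 1] ((1 / 2 : ℂ) • toHolo hv) = toHolo (analyticOnNhd_betaf hv i) := by
  rw [Function.Commute.iterate_left (f := holoPd hΩ 1) (g := ((1 / 2 : ℂ) • ·))
    (fun f => (holoPd hΩ 1).map_smul _ f), iterate_holoPd_toHolo]
  rfl

theorem aeval_holo_apply (β : Fin 3 × Fin g → holo Ω) (P : Bg g) (t : Ω) :
    (aeval β P : holo Ω).1 t = eval (fun w => (β w).1 t) P := by
  have := comp_aeval_apply (B := ℂ) β ((Pi.evalAlgHom ℂ (fun _ : Ω => ℂ) t).comp (holo Ω).val) P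
  rw [aeval_eq_eval] at this
  exact this

end Holomorphic

/-- if the operators L, B₃, …, B_{2g+1} commute then, for every odd
s = 2s'−1 with 1 ≤ s' ≤ g, every i ∈ {1,2,3} and every odd j = 2m−1 with 1 ≤ m ≤ g,
∂_s β_{i,j} = (D_s(b_{i,j}))(β) identically on Ω. -/
theorem stmt18 (g : ℕ) (hg : 1 ≤ g) (Ω : Set (Fin g → ℂ)) (hΩ : IsOpen Ω)
    (hconn : IsConnected Ω)
    (v : ℕ → (Fin g → ℂ) → ℂ) (hv : ∀ m, 1 ≤ m → m ≤ g → AnalyticOnNhd ℂ (v m) Ω)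
    (hcomm : OpsCommute g Ω v) :
    ∀ s, 1 ≤ s → s ≤ g → ∀ i, 1 ≤ i → i ≤ 3 → ∀ m, 1 ≤ m → m ≤ g → ∀ t ∈ Ω,
      pd g s (betaf g v i m) t = evalBeta g v t (Dsg g (2 * s - 1) (bb g i m)) := by
  obtain ⟨x, hx⟩ := exists_holoPd_one_eq_one hΩ hg
  let b (m : ℕ) : holo Ω :=
    if h : 1 ≤ m ∧ m ≤ g then (1 / 2 : ℂ) • toHolo (hv m h.1 h.2) else 0
  have hbv m (hm : 1 ≤ m) (hmg : m ≤ g) : b m = (1 / 2 : ℂ) • toHolo (hv m hm hmg) :=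
    dif_pos ⟨hm, hmg⟩
  have hb2 m (hm : 1 ≤ m) (hmg : m ≤ g) : 2 * b m = toHolo (hv m hm hmg) := by
    rw [hbv m hm hmg, ofNat_mul_eq_smul, smul_smul]
    norm_num
  have hL k (f : holo Ω) (hk : 1 ≤ k) (hkg : k ≤ g) :
      holoPd hΩ 1 (holoPd hΩ 1
          (fourB (holoPd hΩ 1) (holoPd hΩ k) (holoPd hΩ (k + 1)) (2 * b 1) (2 * b k) f))
          - 2 * b 1 * fourB (holoPd hΩ 1) (holoPd hΩ k) (holoPd hΩ (k + 1)) (2 * b 1) (2 * b k) f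
        = fourB (holoPd hΩ 1) (holoPd hΩ k) (holoPd hΩ (k + 1)) (2 * b 1) (2 * b k)
          (holoPd hΩ 1 (holoPd hΩ 1 f) - 2 * b 1 * f) := by
    obtain ⟨F, hF, rfl⟩ := exists_eq_toHolo f
    simp only [hb2 1 le_rfl hg, hb2 k hk hkg, fourB_toHolo, Derivation.map_smul, mul_smul_comm,
      ← smul_sub, holoPd_sub_mul_toHolo]
    exact congrArg _ (toHolo_eq_iff.2 (hcomm F hF k k hk hkg hk hkg).1)
  have hB k l (f : holo Ω) (hk : 1 ≤ k) (hkg : k ≤ g) (hl : 1 ≤ l) (hlg : l ≤ g) :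
      fourB (holoPd hΩ 1) (holoPd hΩ k) (holoPd hΩ (k + 1)) (2 * b 1) (2 * b k)
          (fourB (holoPd hΩ 1) (holoPd hΩ l) (holoPd hΩ (l + 1)) (2 * b 1) (2 * b l) f)
        = fourB (holoPd hΩ 1) (holoPd hΩ l) (holoPd hΩ (l + 1)) (2 * b 1) (2 * b l)
          (fourB (holoPd hΩ 1) (holoPd hΩ k) (holoPd hΩ (k + 1)) (2 * b 1) (2 * b k) f) := by
    obtain ⟨F, hF, rfl⟩ := exists_eq_toHolo f
    simp only [hb2 1 le_rfl hg, hb2 k hk hkg, hb2 l hl hlg, fourB_toHolo, fourB_smul]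
    exact congrArg _ (congrArg _ (toHolo_eq_iff.2 (hcomm F hF k l hk hkg hl hlg).2))
  intro s hs hsg i hi hi' m hm hmg t ht
  have key := derivation_aeval_bb (b := b) (holoPd_comm hΩ) (fun _ => holoPd_eq_zero hΩ)
    (fun m hm => dif_neg (by omega) : ∀ m, g < m → b m = 0) hx hL hB hs hsg hi hi' hm hmg
  rw [hbv m hm hmg, iterate_holoPd_half_smul, holoPd_toHolo] at key
  refine (congrFun (congrArg Subtype.val key) ⟨t, ht⟩).trans ?_
  rw [aeval_holo_apply, evalBeta]
  congr 2
  ext w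
  have hw := iterate_holoPd_half_smul hΩ (hv (w.2 + 1) (by omega) (by omega)) (w.1 + 1)
  rw [betaVal, hbv _ (by omega) (by omega)]
  exact congrFun (congrArg Subtype.val hw) ⟨t, ht⟩

end
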